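/- arXiv:2212.04228 — 2 statements merged into one kernel-verified Lean document; each statement's English description precedes it below -/
import Mathlib

section
/- Let A and B be complex vector spaces of dimensions a and b respectively, and let X : A → B be a linear map of rank r. Let Θ_X : A ⊗ A ⊗ B → A ⊗ ⋀²B be the linear map determined by Θ_X(x ⊗ y ⊗ b) = x ⊗ (X(y) ∧ b) + y ⊗ (X(x) ∧ b). Then rank Θ_X = a·b·r − a·C(r+1,2) − b·C(r,2) + 2·C(r+1,3), where C(·,·) denotes binomial coefficients. (In particular the rank of Θ_X depends only on the rank of X.) -/
open Module LinearMap ExteriorAlgebra TensorProduct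

/-- The second exterior power `⋀²B`, as a submodule of the exterior algebra. -/
noncomputable def extSq (B : Type*) [AddCommGroup B] [Module ℂ B] :
    Submodule ℂ (ExteriorAlgebra ℂ B) := ⋀[ℂ]^2 B

variable {A B : Type*} [AddCommGroup A] [Module ℂ A] [AddCommGroup B] [Module ℂ B]

/-- The wedge product `B × B → ⋀²B` as a bilinear map. -/
noncomputable def wedge2 : B →ₗ[ℂ] B →ₗ[ℂ] extSq B :=
  LinearMap.mk₂ ℂ
    (fun x y => ⟨ι ℂ x * ι ℂ y, by
      have h := Submodule.mul_mem_mul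
        (LinearMap.mem_range_self (ι ℂ : B →ₗ[ℂ] ExteriorAlgebra ℂ B) x)
        (LinearMap.mem_range_self (ι ℂ : B →ₗ[ℂ] ExteriorAlgebra ℂ B) y)
      rwa [← pow_two] at h⟩)
    (fun x x' y => Subtype.ext <| by simp [add_mul])
    (fun c x y => Subtype.ext <| by simp [smul_mul_assoc])
    (fun x y y' => Subtype.ext <| by simp [mul_add])
    (fun c x y => Subtype.ext <| by simp [mul_smul_comm])

/-- The Eagon–Northcott-type map `Θ_X : A ⊗ A ⊗ B → A ⊗ ⋀²B` induced by `X : A → B`,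
determined by `Θ_X(x ⊗ y ⊗ b) = x ⊗ (X(y) ∧ b) + y ⊗ (X(x) ∧ b)`. -/
noncomputable def Theta (X : A →ₗ[ℂ] B) :
    (A ⊗[ℂ] A) ⊗[ℂ] B →ₗ[ℂ] A ⊗[ℂ] (extSq B) :=
  TensorProduct.lift <| TensorProduct.lift <| LinearMap.mk₂ ℂ
    (fun x y => (TensorProduct.mk ℂ A (extSq B) x) ∘ₗ (wedge2 (X y))
      + (TensorProduct.mk ℂ A (extSq B) y) ∘ₗ (wedge2 (X x)))
    (fun x x' y => LinearMap.ext fun b => by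
      simp only [map_add, LinearMap.add_apply, LinearMap.comp_apply, mk_apply,
        add_tmul, tmul_add]; abel)
    (fun c x y => LinearMap.ext fun b => by
      simp only [map_smul, LinearMap.smul_apply, LinearMap.comp_apply, mk_apply,
        smul_tmul', tmul_smul, smul_add, LinearMap.smul_comp, LinearMap.comp_smul])
    (fun x y y' => LinearMap.ext fun b => by
      simp only [map_add, LinearMap.add_apply, LinearMap.comp_apply, mk_apply,
        add_tmul, tmul_add]; abel)
    (fun c x y => LinearMap.ext fun b => by
      simp only [map_smul, LinearMap.smul_apply, LinearMap.comp_apply, mk_apply,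
        smul_tmul', tmul_smul, smul_add, LinearMap.smul_comp, LinearMap.comp_smul])

section AdaptedBases

variable {I J : Type*}

/-- The coordinate `(j, k)` of a bivector with respect to the basis `f`. -/
noncomputable def extSqCoord (f : Basis J ℂ B) (j k : J) : extSq B →ₗ[ℂ] ℂ :=
  exteriorPower.pairingDual ℂ B 2 (exteriorPower.ιMulti ℂ 2 ![f.coord j, f.coord k])

theorem wedge2_eq_ιMulti (u v : B) : wedge2 u v = exteriorPower.ιMulti ℂ 2 ![u, v] :=
  Subtype.ext <| by simp [wedge2, ExteriorAlgebra.ιMulti_apply]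

theorem wedge2_swap (u v : B) : wedge2 u v = -wedge2 v u :=
  Subtype.ext <| eq_neg_of_add_eq_zero_left <| ι_add_mul_swap u v

theorem extSqCoord_wedge2 (f : Basis J ℂ B) (j k : J) (u v : B) :
    extSqCoord f j k (wedge2 u v) = f.coord j u * f.coord k v - f.coord k u * f.coord j v := by
  rw [wedge2_eq_ιMulti]
  refine (exteriorPower.pairingDual_ιMulti_ιMulti _ _).trans ?_
  simp [Matrix.det_fin_two]

theorem extSq_hom_ext {N : Type*} [AddCommGroup N] [Module ℂ N] {g h : extSq B →ₗ[ℂ] N}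
    (H : ∀ u v, g (wedge2 u v) = h (wedge2 u v)) : g = h := by
  refine exteriorPower.linearMap_ext (AlternatingMap.ext fun w => ?_)
  have hw : w = ![w 0, w 1] := by ext i; fin_cases i <;> rfl
  have := H (w 0) (w 1)
  rwa [wedge2_eq_ιMulti, ← hw] at this

/-- The coordinate `(i, j, k)` of an element of `A ⊗ ⋀²B` with respect to bases of `A` and `B`. -/
noncomputable def tensorExtSqCoord (e : Basis I ℂ A) (f : Basis J ℂ B) (i : I) (j k : J) :
    A ⊗[ℂ] extSq B →ₗ[ℂ] ℂ :=
  TensorProduct.lift ((LinearMap.mul ℂ ℂ).compl₁₂ (e.coord i) (extSqCoord f j k))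

@[simp]
theorem tensorExtSqCoord_tmul_wedge2 (e : Basis I ℂ A) (f : Basis J ℂ B) (i : I) (j k : J)
    (x : A) (u v : B) :
    tensorExtSqCoord e f i j k (x ⊗ₜ wedge2 u v) =
      e.coord i x * (f.coord j u * f.coord k v - f.coord k u * f.coord j v) := by
  simp [tensorExtSqCoord, extSqCoord_wedge2]

theorem two_smul_eq_sum_tensorExtSqCoord [Fintype I] [Fintype J]
    (e : Basis I ℂ A) (f : Basis J ℂ B) (T : A ⊗[ℂ] extSq B) :
    (2 : ℂ) • T =
      ∑ i, ∑ j, ∑ k, tensorExtSqCoord e f i j k T • (e i ⊗ₜ[ℂ] wedge2 (f j) (f k)) := by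
  suffices H : (2 : ℂ) • LinearMap.id = ∑ i, ∑ j, ∑ k,
      (tensorExtSqCoord e f i j k).smulRight (e i ⊗ₜ[ℂ] wedge2 (f j) (f k)) by
    simpa using LinearMap.congr_fun H T
  refine TensorProduct.ext (LinearMap.ext fun x => extSq_hom_ext fun u v => ?_)
  have hwedge (u v : B) :
      wedge2 u v = ∑ j, ∑ k, (f.coord j u * f.coord k v) • wedge2 (f j) (f k) := by
    conv_lhs => rw [← f.sum_repr u, ← f.sum_repr v]
    simp only [map_sum, map_smul, LinearMap.sum_apply, LinearMap.smul_apply, Finset.smul_sum,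
      smul_smul, Basis.coord_apply]
    rw [Finset.sum_comm]
    simp only [mul_comm]
  have hskew : (2 : ℂ) • wedge2 u v = ∑ j, ∑ k,
      (f.coord j u * f.coord k v - f.coord k u * f.coord j v) • wedge2 (f j) (f k) := by
    rw [two_smul]
    nth_rw 2 [wedge2_swap]
    rw [← sub_eq_add_neg, hwedge u v, hwedge v u]
    simp only [← Finset.sum_sub_distrib, mul_comm (f.coord _ v)]
    exact Fintype.sum_congr _ _ fun j => Fintype.sum_congr _ _ fun k => (sub_smul _ _ _).symm
  have hx : x = ∑ i, e.coord i x • e i := (e.sum_repr x).symm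
  calc (2 : ℂ) • x ⊗ₜ[ℂ] wedge2 u v = x ⊗ₜ[ℂ] ((2 : ℂ) • wedge2 u v) :=
        (TensorProduct.tmul_smul _ _ _).symm
    _ = ∑ i, ∑ j, ∑ k, tensorExtSqCoord e f i j k (x ⊗ₜ wedge2 u v) •
          (e i ⊗ₜ[ℂ] wedge2 (f j) (f k)) := by
        rw [hskew]
        conv_lhs => rw [hx]
        simp only [TensorProduct.sum_tmul, TensorProduct.tmul_sum, TensorProduct.smul_tmul_smul,
          tensorExtSqCoord_tmul_wedge2]
        rw [Finset.sum_comm_cycle]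
    _ = _ := by simp

theorem eq_zero_of_tensorExtSqCoord_eq_zero [Finite I] [Finite J]
    (e : Basis I ℂ A) (f : Basis J ℂ B) (T : A ⊗[ℂ] extSq B)
    (h : ∀ i j k, tensorExtSqCoord e f i j k T = 0) : T = 0 := by
  cases nonempty_fintype I
  cases nonempty_fintype J
  have := two_smul_eq_sum_tensorExtSqCoord e f T
  simpa [h] using this

@[simp]
theorem Theta_tmul (X : A →ₗ[ℂ] B) (x y : A) (b : B) :
    Theta X ((x ⊗ₜ y) ⊗ₜ b) = x ⊗ₜ wedge2 (X y) b + y ⊗ₜ wedge2 (X x) b := by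
  simp [Theta]

theorem tensorExtSqCoord_swap (e : Basis I ℂ A) (f : Basis J ℂ B) (i : I) (j k : J)
    (T : A ⊗[ℂ] extSq B) :
    tensorExtSqCoord e f i j k T = -tensorExtSqCoord e f i k j T := by
  suffices H : tensorExtSqCoord e f i j k = -tensorExtSqCoord e f i k j by
    simpa using LinearMap.congr_fun H T
  refine TensorProduct.ext (LinearMap.ext fun x => extSq_hom_ext fun u v => ?_)
  simp
  ring

end AdaptedBases

/-- Every linear map of rank `r` becomes a diagonal projection in suitable bases. -/
theorem LinearMap.exists_basis_adapted [FiniteDimensional ℂ A] [FiniteDimensional ℂ B]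
    (X : A →ₗ[ℂ] B) {r : ℕ} (hX : finrank ℂ (LinearMap.range X) = r) :
    ∃ (m n : ℕ) (e : Basis (Fin r ⊕ Fin m) ℂ A) (f : Basis (Fin r ⊕ Fin n) ℂ B),
      (∀ i, X (e (.inl i)) = f (.inl i)) ∧ ∀ i, X (e (.inr i)) = 0 := by
  obtain ⟨C, hC⟩ := (LinearMap.ker X).exists_isCompl
  obtain ⟨D, hD⟩ := (LinearMap.range X).exists_isCompl
  let g := finBasisOfFinrankEq ℂ _ hX
  let E := X.kerComplementEquivRange hC.symm
  refine ⟨_, _, ((g.map E.symm).prod (finBasis ℂ (LinearMap.ker X))).map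
      (Submodule.prodEquivOfIsCompl _ _ hC.symm),
    (g.prod (finBasis ℂ D)).map (Submodule.prodEquivOfIsCompl _ _ hD), fun i => ?_, fun i => ?_⟩
  · have : X (E.symm (g i)) = (E (E.symm (g i)) : B) := rfl
    simp [this]
  · simp

section Rank

variable {r m n : ℕ}

/-- The coordinates of `A ⊗ ⋀²B` which parametrize the range of `Theta X` in adapted bases. -/
def IsPivot : Fin r ⊕ Fin m → Fin r ⊕ Fin n → Fin r ⊕ Fin n → Prop
  | .inl i, .inl j, .inl k => j < k ∧ (i ≤ j ∨ k ≤ i)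
  | .inl i, .inl j, .inr _ => i ≤ j
  | .inr _, .inl j, .inl k => j < k
  | .inr _, .inl _, .inr _ => True
  | _, .inr _, _ => False

theorem sum_sum_lt (r : ℕ) :
    ∑ j : Fin r, ∑ k : Fin r, (if j < k then 1 else 0) = r.choose 2 := by
  induction r with
  | zero => rfl
  | succ r ih =>
    rw [Nat.choose_succ_succ' r 1, Nat.choose_one_right]
    simp [-Finset.sum_boole, Fin.sum_univ_castSucc, Finset.sum_add_distrib, ih,
      (Fin.le_last _).not_gt, add_comm]

theorem sum_sum_le (r : ℕ) :
    ∑ j : Fin r, ∑ k : Fin r, (if j ≤ k then 1 else 0) = (r + 1).choose 2 := by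
  induction r with
  | zero => rfl
  | succ r ih =>
    rw [Nat.choose_succ_succ' (r + 1) 1, Nat.choose_one_right]
    simp [-Finset.sum_boole, Fin.sum_univ_castSucc, Finset.sum_add_distrib, ih, Fin.le_last]
    omega

theorem sum_sum_sum_lt_le (r : ℕ) :
    ∑ i : Fin r, ∑ j : Fin r, ∑ k : Fin r, (if j < k ∧ i ≤ j then 1 else 0) =
      (r + 1).choose 3 := by
  induction r with
  | zero => rfl
  | succ r ih =>
    rw [Nat.choose_succ_succ' (r + 1) 2]
    simp [-Finset.sum_boole, Fin.sum_univ_castSucc, Finset.sum_add_distrib, ih, sum_sum_le,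
      (Fin.le_last _).not_gt]
    omega

theorem sum_sum_sum_lt_ge (r : ℕ) :
    ∑ i : Fin r, ∑ j : Fin r, ∑ k : Fin r, (if j < k ∧ k ≤ i then 1 else 0) =
      (r + 1).choose 3 := by
  induction r with
  | zero => rfl
  | succ r ih =>
    rw [Nat.choose_succ_succ' (r + 1) 2]
    simp [-Finset.sum_boole, Fin.sum_univ_castSucc, Finset.sum_add_distrib, ih, sum_sum_lt,
      (Fin.le_last _).not_gt, Fin.le_last, Nat.choose_succ_succ' r 1]
    omega

open Classical in
theorem card_isPivot :
    (Fintype.card {p : (Fin r ⊕ Fin m) × (Fin r ⊕ Fin n) × (Fin r ⊕ Fin n) //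
      IsPivot p.1 p.2.1 p.2.2}) =
    m * r * n + m * r.choose 2 + n * (r + 1).choose 2 + 2 * (r + 1).choose 3 := by
  have hsplit : ∑ i : Fin r, ∑ j : Fin r, ∑ k : Fin r, (if j < k ∧ (i ≤ j ∨ k ≤ i) then 1 else 0) =
      2 * (r + 1).choose 3 := by
    rw [two_mul]
    nth_rw 1 [← sum_sum_sum_lt_le]
    rw [← sum_sum_sum_lt_ge]
    simp only [← Finset.sum_add_distrib]
    refine Fintype.sum_congr _ _ fun i => Fintype.sum_congr _ _ fun j =>
      Fintype.sum_congr _ _ fun k => ?_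
    grind
  have hlll (i : Fin r) (j k : Fin r) : (if IsPivot (m := m) (n := n) (.inl i) (.inl j) (.inl k)
      then 1 else 0) = if j < k ∧ (i ≤ j ∨ k ≤ i) then 1 else 0 := if_congr Iff.rfl rfl rfl
  have hllr (i j : Fin r) (k : Fin n) : (if IsPivot (m := m) (.inl i) (.inl j) (.inr k)
      then 1 else 0) = if i ≤ j then 1 else 0 := if_congr Iff.rfl rfl rfl
  have hrll (i : Fin m) (j k : Fin r) : (if IsPivot (n := n) (.inr i) (.inl j) (.inl k)
      then 1 else 0) = if j < k then 1 else 0 := if_congr Iff.rfl rfl rfl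
  have hrlr (i : Fin m) (j : Fin r) (k : Fin n) : IsPivot (.inr i) (.inl j) (.inr k) := trivial
  have hr (i : Fin r ⊕ Fin m) (j : Fin n) (k) : ¬ IsPivot i (.inr j) k := by
    rcases i with i | i <;> exact id
  rw [Fintype.card_subtype, Finset.card_filter]
  simp only [Fintype.sum_prod_type, Fintype.sum_sum_type, hlll, hllr, hrll, hrlr, hr, hsplit,
    sum_sum_lt, Finset.sum_add_distrib, if_true, if_false, Finset.sum_const,
    Finset.card_univ, Fintype.card_fin, smul_eq_mul, ← Finset.mul_sum, sum_sum_le]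
  ring

variable {e : Basis (Fin r ⊕ Fin m) ℂ A} {f : Basis (Fin r ⊕ Fin n) ℂ B} {X : A →ₗ[ℂ] B}

theorem coord_inl_apply (hl : ∀ i, X (e (.inl i)) = f (.inl i)) (hr : ∀ i, X (e (.inr i)) = 0)
    (j : Fin r) (x : A) : f.repr (X x) (.inl j) = e.repr x (.inl j) := by
  suffices H : f.coord (.inl j) ∘ₗ X = e.coord (.inl j) by simpa using LinearMap.congr_fun H x
  refine e.ext fun i => ?_
  rcases i with i | i <;> simp [hl, hr, Finsupp.single_apply]

theorem coord_inr_apply (hl : ∀ i, X (e (.inl i)) = f (.inl i)) (hr : ∀ i, X (e (.inr i)) = 0)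
    (j : Fin n) (x : A) : f.repr (X x) (.inr j) = 0 := by
  suffices H : f.coord (.inr j) ∘ₗ X = 0 by simpa using LinearMap.congr_fun H x
  refine e.ext fun i => ?_
  rcases i with i | i <;> simp [hl, hr]

theorem tensorExtSqCoord_Theta_inr_inr
    (hl : ∀ i, X (e (.inl i)) = f (.inl i)) (hr : ∀ i, X (e (.inr i)) = 0)
    (i : Fin r ⊕ Fin m) (j k : Fin n) (t : (A ⊗[ℂ] A) ⊗[ℂ] B) :
    tensorExtSqCoord e f i (.inr j) (.inr k) (Theta X t) = 0 := by
  suffices H : tensorExtSqCoord e f i (.inr j) (.inr k) ∘ₗ Theta X = 0 from LinearMap.congr_fun H t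
  refine TensorProduct.ext_threefold fun x y b => ?_
  simp [coord_inr_apply hl hr]

theorem tensorExtSqCoord_Theta_inl_inr
    (hl : ∀ i, X (e (.inl i)) = f (.inl i)) (hr : ∀ i, X (e (.inr i)) = 0)
    (i j : Fin r) (k : Fin n) (t : (A ⊗[ℂ] A) ⊗[ℂ] B) :
    tensorExtSqCoord e f (.inl i) (.inl j) (.inr k) (Theta X t) =
      tensorExtSqCoord e f (.inl j) (.inl i) (.inr k) (Theta X t) := by
  suffices H : tensorExtSqCoord e f (.inl i) (.inl j) (.inr k) ∘ₗ Theta X =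
      tensorExtSqCoord e f (.inl j) (.inl i) (.inr k) ∘ₗ Theta X from LinearMap.congr_fun H t
  refine TensorProduct.ext_threefold fun x y b => ?_
  simp [coord_inr_apply hl hr, coord_inl_apply hl hr]
  ring

theorem tensorExtSqCoord_Theta_cyclic
    (hl : ∀ i, X (e (.inl i)) = f (.inl i)) (hr : ∀ i, X (e (.inr i)) = 0)
    (i j k : Fin r) (t : (A ⊗[ℂ] A) ⊗[ℂ] B) :
    tensorExtSqCoord e f (.inl i) (.inl j) (.inl k) (Theta X t) =
      tensorExtSqCoord e f (.inl j) (.inl i) (.inl k) (Theta X t) -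
        tensorExtSqCoord e f (.inl k) (.inl i) (.inl j) (Theta X t) := by
  suffices H : tensorExtSqCoord e f (.inl i) (.inl j) (.inl k) ∘ₗ Theta X =
      tensorExtSqCoord e f (.inl j) (.inl i) (.inl k) ∘ₗ Theta X -
        tensorExtSqCoord e f (.inl k) (.inl i) (.inl j) ∘ₗ Theta X from LinearMap.congr_fun H t
  refine TensorProduct.ext_threefold fun x y b => ?_
  simp [coord_inl_apply hl hr]
  ring

theorem Theta_eq_zero_of_isPivot
    (hl : ∀ i, X (e (.inl i)) = f (.inl i)) (hr : ∀ i, X (e (.inr i)) = 0)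
    (t : (A ⊗[ℂ] A) ⊗[ℂ] B)
    (h : ∀ i j k, IsPivot i j k → tensorExtSqCoord e f i j k (Theta X t) = 0) :
    Theta X t = 0 := by
  have hself (i j) : tensorExtSqCoord e f i j j (Theta X t) = 0 :=
    self_eq_neg.mp (tensorExtSqCoord_swap e f i j j _)
  have hinr (i j k) : tensorExtSqCoord e f i (.inl j) (.inr k) (Theta X t) = 0 := by
    rcases i with i | i
    · rcases le_total i j with hij | hij
      · exact h _ _ _ hij
      · rw [tensorExtSqCoord_Theta_inl_inr hl hr]
        exact h _ _ _ hij
    · exact h _ _ _ trivial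
  have hlt (i) (j k : Fin r) (hjk : j < k) :
      tensorExtSqCoord e f i (.inl j) (.inl k) (Theta X t) = 0 := by
    rcases i with i | i
    · by_cases hi : i ≤ j ∨ k ≤ i
      · exact h _ _ _ ⟨hjk, hi⟩
      · push Not at hi
        rw [tensorExtSqCoord_Theta_cyclic hl hr, h (.inl j) (.inl i) (.inl k) ⟨hi.2, .inl hi.1.le⟩,
          tensorExtSqCoord_swap e f (.inl k), h (.inl k) (.inl j) (.inl i) ⟨hi.1, .inr hi.2.le⟩]
        simp
    · exact h _ _ _ hjk
  refine eq_zero_of_tensorExtSqCoord_eq_zero e f _ fun i j k => ?_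
  rcases j with j | j <;> rcases k with k | k
  · rcases lt_trichotomy j k with hjk | rfl | hjk
    · exact hlt i j k hjk
    · exact hself _ _
    · rw [tensorExtSqCoord_swap, hlt i k j hjk, neg_zero]
  · exact hinr i j k
  · rw [tensorExtSqCoord_swap, hinr, neg_zero]
  · exact tensorExtSqCoord_Theta_inr_inr hl hr i j k t

theorem exists_Theta_coord_eq_single
    (hl : ∀ i, X (e (.inl i)) = f (.inl i)) (hr : ∀ i, X (e (.inr i)) = 0)
    {i : Fin r ⊕ Fin m} {j k : Fin r ⊕ Fin n} (h : IsPivot i j k) :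
    ∃ t, tensorExtSqCoord e f i j k (Theta X t) ≠ 0 ∧ ∀ i' j' k', IsPivot i' j' k' →
      (i', j', k') ≠ (i, j, k) → tensorExtSqCoord e f i' j' k' (Theta X t) = 0 := by
  rcases j with j | j
  swap
  · cases i <;> exact h.elim
  rcases i with i | i <;> rcases k with k | k
  · obtain ⟨hjk, hi | hi⟩ := h
    · refine ⟨(e (.inl i) ⊗ₜ e (.inl j)) ⊗ₜ f (.inl k), ?_, fun i' j' k' h' hne => ?_⟩
      · simp [hl, Finsupp.single_apply]
        grind
      · rcases i' with i' | i' <;> rcases j' with j' | j' <;> rcases k' with k' | k' <;>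
          simp [IsPivot] at h' <;> simp [hl, Finsupp.single_apply] at hne ⊢
        grind
    · refine ⟨(e (.inl i) ⊗ₜ e (.inl k)) ⊗ₜ f (.inl j), ?_, fun i' j' k' h' hne => ?_⟩
      · simp [hl, Finsupp.single_apply]
        grind
      · rcases i' with i' | i' <;> rcases j' with j' | j' <;> rcases k' with k' | k' <;>
          simp [IsPivot] at h' <;> simp [hl, Finsupp.single_apply] at hne ⊢
        grind
  · have hij : i ≤ j := h
    refine ⟨(e (.inl i) ⊗ₜ e (.inl j)) ⊗ₜ f (.inr k), ?_, fun i' j' k' h' hne => ?_⟩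
    · simp [hl, Finsupp.single_apply]
      grind
    · rcases i' with i' | i' <;> rcases j' with j' | j' <;> rcases k' with k' | k' <;>
        simp [IsPivot] at h' <;> simp [hl, Finsupp.single_apply] at hne ⊢
      grind
  · have hjk : j < k := h
    refine ⟨(e (.inr i) ⊗ₜ e (.inl j)) ⊗ₜ f (.inl k), ?_, fun i' j' k' h' hne => ?_⟩
    · simp [hl, hr, Finsupp.single_apply]
      grind
    · rcases i' with i' | i' <;> rcases j' with j' | j' <;> rcases k' with k' | k' <;>
        simp [IsPivot] at h' <;> simp [hl, hr, Finsupp.single_apply] at hne ⊢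
      grind
  · refine ⟨(e (.inr i) ⊗ₜ e (.inl j)) ⊗ₜ f (.inr k), ?_, fun i' j' k' h' hne => ?_⟩
    · simp [hl, hr]
    · rcases i' with i' | i' <;> rcases j' with j' | j' <;> rcases k' with k' | k' <;>
        simp [IsPivot] at h' <;> simp [hl, hr, Finsupp.single_apply] at hne ⊢
      grind

theorem finrank_range_Theta
    (hl : ∀ i, X (e (.inl i)) = f (.inl i)) (hr : ∀ i, X (e (.inr i)) = 0) :
    finrank ℂ (LinearMap.range (Theta X)) =
      m * r * n + m * r.choose 2 + n * (r + 1).choose 2 + 2 * (r + 1).choose 3 := by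
  classical
  let S := {p : (Fin r ⊕ Fin m) × (Fin r ⊕ Fin n) × (Fin r ⊕ Fin n) // IsPivot p.1 p.2.1 p.2.2}
  let π : A ⊗[ℂ] extSq B →ₗ[ℂ] S → ℂ :=
    LinearMap.pi fun p => tensorExtSqCoord e f p.1.1 p.1.2.1 p.1.2.2
  have hinj : Function.Injective (π.domRestrict (LinearMap.range (Theta X))) := by
    rw [injective_iff_map_eq_zero]
    rintro ⟨_, t, rfl⟩ ht
    refine Subtype.ext (Theta_eq_zero_of_isPivot hl hr t fun i j k hijk => ?_)
    exact congrFun ht ⟨(i, j, k), hijk⟩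
  have hsurj : Function.Surjective (π.domRestrict (LinearMap.range (Theta X))) := by
    rw [← LinearMap.range_eq_top, eq_top_iff, ← (Pi.basisFun ℂ S).span_eq, Submodule.span_le]
    rintro _ ⟨⟨⟨i, j, k⟩, hp⟩, rfl⟩
    obtain ⟨t, ht, ht'⟩ := exists_Theta_coord_eq_single hl hr hp
    refine ⟨(tensorExtSqCoord e f i j k (Theta X t))⁻¹ • ⟨Theta X t, t, rfl⟩, ?_⟩
    ext ⟨⟨i', j', k'⟩, hp'⟩
    by_cases hq : (i', j', k') = (i, j, k)
    · obtain ⟨rfl, rfl, rfl⟩ := by simpa using hq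
      simp [π, ht]
    · have hq' : (⟨(i', j', k'), hp'⟩ : S) ≠ ⟨(i, j, k), hp⟩ := fun h => hq (congrArg Subtype.val h)
      simp [π, ht' _ _ _ hp' hq, hq']
  rw [(LinearEquiv.ofBijective _ ⟨hinj, hsurj⟩).finrank_eq, finrank_fintype_fun_eq_card,
    card_isPivot]

end Rank

set_option maxHeartbeats 800000 in
/-- If `dim A = a`, `dim B = b` and `X : A → B` has rank `r`, then the induced map
`Θ_X : A ⊗ A ⊗ B → A ⊗ ⋀²B` has rank `abr − a·C(r+1,2) − b·C(r,2) + 2·C(r+1,3)`;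
in particular the rank of `Θ_X` only depends on the rank of `X`. -/
theorem rank_Theta [FiniteDimensional ℂ A] [FiniteDimensional ℂ B]
    {a b r : ℕ} (ha : finrank ℂ A = a) (hb : finrank ℂ B = b)
    (X : A →ₗ[ℂ] B) (hX : finrank ℂ (LinearMap.range X) = r) :
    (finrank ℂ (LinearMap.range (Theta X)) : ℤ) =
      a * b * r - a * (r + 1).choose 2 - b * r.choose 2 + 2 * (r + 1).choose 3 := by
  obtain ⟨m, n, e, f, hl, hr⟩ := X.exists_basis_adapted hX
  have ha' : a = r + m := by rw [← ha, finrank_eq_card_basis e]; simp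
  have hb' : b = r + n := by rw [← hb, finrank_eq_card_basis f]; simp
  have h1 : ((r + 1).choose 2 : ℤ) = r + r.choose 2 := by
    simp [Nat.choose_succ_succ' r 1]
  have h2 : (r : ℤ) * r = r + 2 * r.choose 2 := by
    clear * -
    induction r with
    | zero => simp
    | succ r ih =>
      rw [Nat.choose_succ_succ' r 1]
      push_cast [Nat.choose_one_right]
      linear_combination ih
  rw [finrank_range_Theta hl hr, ha', hb']
  push_cast
  rw [h1]
  linear_combination -(m + n + r : ℤ) * h2
end

section
/- Let ℂ[x,y]_d denote the space of homogeneous polynomials of degree d in two variables over ℂ, and let d ≥ 1. For a nonzero c ∈ ℂ[x,y]_3, define the linear map T_c : ℂ[x,y]_{3d} → ℂ[x,y]_{3d+1} by T_c(f) = (∂c/∂x)(∂f/∂y) − (∂c/∂y)(∂f/∂x). Then for every nonzero c ∈ ℂ[x,y]_3, the kernel of T_c is exactly the line spanned by c^d; hence rank T_c = 3d, independent of the nonzero c. -/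
open Module LinearMap MvPolynomial

/-- The operator `f ↦ (∂c/∂x)(∂f/∂y) − (∂c/∂y)(∂f/∂x)` on polynomials in two variables. -/
noncomputable def jacOp (c : MvPolynomial (Fin 2) ℂ) :
    MvPolynomial (Fin 2) ℂ →ₗ[ℂ] MvPolynomial (Fin 2) ℂ :=
  (LinearMap.mulLeft ℂ (pderiv (0 : Fin 2) c)) ∘ₗ (pderiv (1 : Fin 2)).toLinearMap
    - (LinearMap.mulLeft ℂ (pderiv (1 : Fin 2) c)) ∘ₗ (pderiv (0 : Fin 2)).toLinearMap

namespace Polynomial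

/-- Polynomials with vanishing Wronskian over a field of characteristic zero are proportional. -/
theorem exists_eq_smul_of_mul_derivative_eq {K : Type*} [Field K] [CharZero K]
    {p q : Polynomial K} (hq : q ≠ 0) (h : p * derivative q = derivative p * q) :
    ∃ t : K, p = t • q := by
  have hlc : q.leadingCoeff ≠ 0 := leadingCoeff_ne_zero.mpr hq
  obtain ⟨t, ht⟩ : ∃ t : K, t * q.leadingCoeff = p.coeff q.natDegree :=
    ⟨p.coeff q.natDegree / q.leadingCoeff, div_mul_cancel₀ _ hlc⟩
  refine ⟨t, sub_eq_zero.mp ?_⟩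
  set r := p - t • q with hr
  have hrq : r.coeff q.natDegree = 0 := by
    simp [hr, ← ht]
  have hW : r * (X * derivative q) = (X * derivative r) * q := by
    simp only [hr, derivative_sub, smul_eq_C_mul, derivative_C_mul]
    linear_combination X * h
  have hX : ∀ (s : Polynomial K) (n : ℕ), (X * derivative s).coeff n = n * s.coeff n := by
    intro s n
    cases n with
    | zero => simp
    | succ n => rw [coeff_X_mul, coeff_derivative]; push_cast; ring
  have hdeg : ∀ s : Polynomial K, (X * derivative s).natDegree ≤ s.natDegree := by
    intro s
    refine natDegree_le_iff_coeff_eq_zero.mpr fun n hn => ?_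
    rw [hX, coeff_eq_zero_of_natDegree_lt hn, mul_zero]
  by_contra hr0
  have key := congrArg (fun s => s.coeff (r.natDegree + q.natDegree)) hW
  simp only [coeff_mul_add_eq_of_natDegree_le le_rfl (hdeg q),
    coeff_mul_add_eq_of_natDegree_le (hdeg r) le_rfl, hX] at key
  have hlr : r.coeff r.natDegree ≠ 0 := leadingCoeff_ne_zero.mpr hr0
  have hnm : (q.natDegree : K) = r.natDegree := by
    refine mul_right_cancel₀ (mul_ne_zero hlr hlc) ?_
    rw [leadingCoeff]
    linear_combination key
  rw [Nat.cast_inj.mp hnm] at hrq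
  exact hlr hrq

end Polynomial

namespace MvPolynomial

/-- Setting the second variable equal to `1`. -/
noncomputable def dehomogenize (R : Type*) [CommSemiring R] :
    MvPolynomial (Fin 2) R →ₐ[R] Polynomial R :=
  aeval ![Polynomial.X, 1]

theorem derivative_dehomogenize {R : Type*} [CommSemiring R] (f : MvPolynomial (Fin 2) R) :
    Polynomial.derivative (dehomogenize R f) = dehomogenize R (pderiv 0 f) := by
  induction f using MvPolynomial.induction_on with
  | C a => simp [dehomogenize]
  | add p q hp hq => simp [hp, hq]
  | mul_X p i hp =>
    rw [map_mul, Polynomial.derivative_mul, hp, Derivation.leibniz, map_add]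
    fin_cases i <;> simp [dehomogenize, pderiv_X, mul_comm, add_comm]

theorem IsHomogeneous.eval_smul {σ R : Type*} [CommSemiring R] {f : MvPolynomial σ R} {n : ℕ}
    (hf : f.IsHomogeneous n) (r : R) (v : σ → R) : eval (r • v) f = r ^ n * eval v f := by
  rw [eval_eq, eval_eq, Finset.mul_sum]
  refine Finset.sum_congr rfl fun m hm => ?_
  have hm : m.degree = n := by
    rw [Finsupp.degree_eq_weight_one]; exact hf (mem_support_iff.mp hm)
  simp only [Pi.smul_apply, smul_eq_mul, mul_pow, Finset.prod_mul_distrib,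
    Finset.prod_pow_eq_pow_sum]
  rw [← hm, Finsupp.degree_apply]
  ring

theorem IsHomogeneous.eq_zero_of_dehomogenize_eq_zero {K : Type*} [Field K] [Infinite K]
    {f : MvPolynomial (Fin 2) K} {n : ℕ} (hf : f.IsHomogeneous n)
    (h : dehomogenize K f = 0) : f = 0 := by
  have key : ∀ a : K, eval ![a, 1] f = 0 := by
    intro a
    have h1 : (Polynomial.aeval a).comp (dehomogenize K) = MvPolynomial.aeval ![a, 1] := by
      ext i
      fin_cases i <;> simp [dehomogenize]
    have h2 := DFunLike.congr_fun h1 f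
    rw [AlgHom.comp_apply, h, map_zero] at h2
    exact h2.symm
  have hX : X 1 * f = 0 := by
    refine MvPolynomial.funext fun v => ?_
    by_cases hv : v 1 = 0
    · simp [hv]
    · have hv' : v = v 1 • ![v 0 / v 1, 1] := by
        ext i
        fin_cases i <;> simp [mul_div_cancel₀, hv]
      rw [map_mul, hv', hf.eval_smul, key]
      simp
  exact (mul_eq_zero.mp hX).resolve_left (X_ne_zero 1)

instance finite_homogeneousSubmodule {σ K : Type*} [Finite σ] [CommSemiring K] (n : ℕ) :
    Module.Finite K (homogeneousSubmodule σ K n) :=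
  Module.Finite.iff_fg.mpr (homogeneousSubmodule_fg σ K n)

theorem finrank_homogeneousSubmodule_fin_two (K : Type*) [Field K] (n : ℕ) :
    finrank K (homogeneousSubmodule (Fin 2) K n) = n + 1 := by
  let e : {m : Fin 2 →₀ ℕ | m.degree = n} ≃ Finset.HasAntidiagonal.antidiagonal n :=
    (Finsupp.equivFunOnFinite.trans (finTwoArrowEquiv ℕ)).subtypeEquiv fun m => by
      simp [Finsupp.degree_eq_sum, finTwoArrowEquiv]
  rw [homogeneousSubmodule_eq_finsupp_supported,
    ((AddMonoidAlgebra.supportedEquivFinsupp _).trans (Finsupp.domLCongr e)).finrank_eq,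
    Module.finrank_finsupp_self, Fintype.card_coe, Finset.Nat.card_antidiagonal]

theorem jacOp_apply (c f : MvPolynomial (Fin 2) ℂ) :
    jacOp c f = pderiv 0 c * pderiv 1 f - pderiv 1 c * pderiv 0 f := rfl

theorem jacOp_pow_self (c : MvPolynomial (Fin 2) ℂ) (d : ℕ) : jacOp c (c ^ d) = 0 := by
  rw [jacOp_apply, pderiv_pow, pderiv_pow]
  ring

theorem IsHomogeneous.mul_pderiv_of_jacOp_eq_zero {c f : MvPolynomial (Fin 2) ℂ} {m n : ℕ}
    (hc : c.IsHomogeneous m) (hf : f.IsHomogeneous n) (h : jacOp c f = 0) :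
    n * f * pderiv 0 c = m * c * pderiv 0 f := by
  have h1 := hc.sum_X_mul_pderiv
  have h2 := hf.sum_X_mul_pderiv
  rw [jacOp_apply] at h
  rw [Fin.sum_univ_two, nsmul_eq_mul] at h1 h2
  linear_combination pderiv 0 f * h1 - pderiv 0 c * h2 + X 1 * h

theorem IsHomogeneous.exists_eq_smul_pow_of_jacOp_eq_zero {c f : MvPolynomial (Fin 2) ℂ}
    {m d : ℕ} (hm : m ≠ 0) (hc0 : c ≠ 0) (hc : c.IsHomogeneous m)
    (hf : f.IsHomogeneous (m * d)) (h : jacOp c f = 0) : ∃ t : ℂ, f = t • c ^ d := by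
  have hcd : (c ^ d).IsHomogeneous (m * d) := hc.pow d
  have hm' : (m : MvPolynomial (Fin 2) ℂ) ≠ 0 := Nat.cast_ne_zero.mpr hm
  have h0 : d * f * pderiv 0 c = c * pderiv 0 f := by
    refine mul_left_cancel₀ hm' ?_
    have := hc.mul_pderiv_of_jacOp_eq_zero hf h
    push_cast at this
    linear_combination this
  have h1 : f * pderiv 0 (c ^ d) = pderiv 0 f * c ^ d := by
    rw [pderiv_pow]
    cases d with
    | zero =>
      have h3 := (mul_eq_zero.mp (h0.symm.trans (by simp))).resolve_left hc0
      simp [h3]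
    | succ d =>
      rw [Nat.add_sub_cancel, pow_succ]
      linear_combination c ^ d * h0
  have h2 := congrArg (dehomogenize ℂ) h1
  rw [map_mul, map_mul, ← derivative_dehomogenize, ← derivative_dehomogenize] at h2
  obtain ⟨t, ht⟩ := Polynomial.exists_eq_smul_of_mul_derivative_eq
    (fun h => pow_ne_zero d hc0 (hcd.eq_zero_of_dehomogenize_eq_zero h)) h2
  refine ⟨t, sub_eq_zero.mp ?_⟩
  have hsub : (f - t • c ^ d).IsHomogeneous (m * d) :=
    (homogeneousSubmodule (Fin 2) ℂ (m * d)).sub_mem hf (Submodule.smul_mem _ t hcd)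
  refine hsub.eq_zero_of_dehomogenize_eq_zero ?_
  rw [map_sub, map_smul, ht, sub_self]

end MvPolynomial

/-- For every `d ≥ 1` and every nonzero homogeneous cubic `c` in two variables, the operator
`T_c(f) = (∂c/∂x)(∂f/∂y) − (∂c/∂y)(∂f/∂x)`, restricted to the `(3d+1)`-dimensional space of
homogeneous polynomials of degree `3d` (with values among polynomials of degree `3d+1`),
has kernel exactly the line spanned by `c^d`; hence it has rank `3d`, independent of `c`. -/
theorem jacOp_ker_eq_span_pow_and_rank_eq (d : ℕ) (hd : 1 ≤ d)
    (c : MvPolynomial (Fin 2) ℂ) (hc0 : c ≠ 0)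
    (hc : c ∈ homogeneousSubmodule (Fin 2) ℂ 3) :
    (∀ f : homogeneousSubmodule (Fin 2) ℂ (3 * d),
        (jacOp c).domRestrict (homogeneousSubmodule (Fin 2) ℂ (3 * d)) f = 0 ↔
          ∃ t : ℂ, (f : MvPolynomial (Fin 2) ℂ) = t • c ^ d) ∧
      finrank ℂ (LinearMap.range
        ((jacOp c).domRestrict (homogeneousSubmodule (Fin 2) ℂ (3 * d)))) = 3 * d := by
  have hker : ∀ f : homogeneousSubmodule (Fin 2) ℂ (3 * d),
      (jacOp c).domRestrict (homogeneousSubmodule (Fin 2) ℂ (3 * d)) f = 0 ↔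
        ∃ t : ℂ, (f : MvPolynomial (Fin 2) ℂ) = t • c ^ d := by
    rintro ⟨f, hf⟩
    rw [LinearMap.domRestrict_apply]
    refine ⟨fun h => IsHomogeneous.exists_eq_smul_pow_of_jacOp_eq_zero three_ne_zero hc0 hc hf h, ?_⟩
    rintro ⟨t, rfl⟩
    rw [map_smul, jacOp_pow_self, smul_zero]
  refine ⟨hker, ?_⟩
  let g : homogeneousSubmodule (Fin 2) ℂ (3 * d) := ⟨c ^ d, IsHomogeneous.pow hc d⟩
  have hg : g ≠ 0 := fun h => pow_ne_zero d hc0 (congrArg Subtype.val h)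
  have hspan : LinearMap.ker ((jacOp c).domRestrict (homogeneousSubmodule (Fin 2) ℂ (3 * d)))
      = Submodule.span ℂ {g} := by
    ext f
    rw [LinearMap.mem_ker, hker, Submodule.mem_span_singleton]
    exact exists_congr fun t => ⟨fun h => Subtype.ext h.symm, fun h => congrArg Subtype.val h.symm⟩
  have hrank := LinearMap.finrank_range_add_finrank_ker
    ((jacOp c).domRestrict (homogeneousSubmodule (Fin 2) ℂ (3 * d)))
  rw [hspan, finrank_span_singleton hg, finrank_homogeneousSubmodule_fin_two] at hrank
  exact Nat.add_right_cancel hrank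
end
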